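/- Let q be a prime power and d a positive integer with d < q−1. Define P(q,d) as the total number of cycles of f acting on F_q, summed over all f ∈ F_q[x] with deg(f) = d, divided by the number of polynomials in F_q[x] of degree exactly d. Then P(q,d) ≤ Σ_{k=1}^{d+1} (1/k) + q/(d+2). -/

import Mathlib

open Polynomial

/-- `c` is a cycle of the map `φ`: a nonempty finite set, closed under `φ`, on which `φ` acts
transitively (equivalently, an orbit of periodic points `α₁ → α₂ → ⋯ → α_k → α₁`). -/
def IsCycleSet {S : Type*} (φ : S → S) (c : Finset S) : Prop :=
  c.Nonempty ∧ (∀ x ∈ c, φ x ∈ c) ∧ ∀ x ∈ c, ∀ y ∈ c, ∃ j : ℕ, φ^[j] x = y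

theorem IsCycleSet.minimalPeriod_pos {S : Type*} {φ : S → S} {c : Finset S}
    (hc : IsCycleSet φ c) {x : S} (hx : x ∈ c) : 0 < Function.minimalPeriod φ x := by
  obtain ⟨j, hj⟩ := hc.2.2 _ (hc.2.1 x hx) x hx
  exact Function.IsPeriodicPt.minimalPeriod_pos (n := j + 1) j.succ_pos hj

theorem IsCycleSet.iterate_mem {S : Type*} {φ : S → S} {c : Finset S}
    (hc : IsCycleSet φ c) {x : S} (hx : x ∈ c) (n : ℕ) : φ^[n] x ∈ c := by
  induction n with
  | zero => exact hx
  | succ n ih => rw [Function.iterate_succ_apply']; exact hc.2.1 _ ih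

theorem IsCycleSet.card_eq_minimalPeriod {S : Type*} {φ : S → S} {c : Finset S}
    (hc : IsCycleSet φ c) {x : S} (hx : x ∈ c) : c.card = Function.minimalPeriod φ x := by
  classical
  have himage : c = (Finset.range (Function.minimalPeriod φ x)).image (fun n => φ^[n] x) := by
    ext y
    simp only [Finset.mem_image, Finset.mem_range]
    constructor
    · intro hy
      obtain ⟨j, hj⟩ := hc.2.2 x hx y hy
      exact ⟨j % Function.minimalPeriod φ x, Nat.mod_lt _ (hc.minimalPeriod_pos hx),
        by rw [Function.iterate_mod_minimalPeriod_eq, hj]⟩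
    · rintro ⟨n, -, rfl⟩
      exact hc.iterate_mem hx n
  conv_lhs => rw [himage]
  rw [Finset.card_image_of_injOn, Finset.card_range]
  intro a ha b hb hab
  exact Function.iterate_injOn_Iio_minimalPeriod (by simpa using ha) (by simpa using hb) hab

theorem IsCycleSet.eq_of_mem {S : Type*} {φ : S → S} {c c' : Finset S}
    (hc : IsCycleSet φ c) (hc' : IsCycleSet φ c') {x : S} (hx : x ∈ c) (hx' : x ∈ c') :
    c = c' := by
  ext y
  constructor
  · intro hy
    obtain ⟨j, rfl⟩ := hc.2.2 x hx y hy
    exact hc'.iterate_mem hx' j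
  · intro hy
    obtain ⟨j, rfl⟩ := hc'.2.2 x hx' y hy
    exact hc.iterate_mem hx j

theorem mul_card_cycles_le {S : Type*} {φ : S → S} {C : Finset (Finset S)}
    (hC : ∀ c ∈ C, IsCycleSet φ c) {m : ℕ} (hm : ∀ c ∈ C, m ≤ c.card) {T : Finset S}
    (hT : ∀ c ∈ C, c ⊆ T) : m * C.card ≤ T.card := by
  classical
  calc m * C.card = ∑ _c ∈ C, m := by rw [Finset.sum_const, smul_eq_mul, mul_comm]
    _ ≤ ∑ c ∈ C, c.card := Finset.sum_le_sum hm
    _ = (C.biUnion id).card := by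
        refine (Finset.card_biUnion fun c hc c' hc' hne => ?_).symm
        refine Finset.disjoint_left.2 fun x hx hx' => hne ?_
        exact (hC c hc).eq_of_mem (hC c' hc') hx hx'
    _ ≤ T.card := Finset.card_le_card (Finset.biUnion_subset.2 hT)

section Counting

variable {F : Type*} [Field F]

instance finite_degree_eq [Finite F] (d : ℕ) :
    Finite {f : F[X] // f.degree = (d : WithBot ℕ)} := by
  refine Finite.of_injective
    (fun f : {f : F[X] // f.degree = (d : WithBot ℕ)} => fun i : Fin (d + 1) => f.1.coeff i) ?_
  rintro ⟨f, hf⟩ ⟨g, hg⟩ h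
  refine Subtype.ext (Polynomial.ext fun n => ?_)
  rcases Nat.lt_or_ge d n with hn | hn
  · rw [coeff_eq_zero_of_degree_lt (by rw [hf]; exact_mod_cast hn),
      coeff_eq_zero_of_degree_lt (by rw [hg]; exact_mod_cast hn)]
  · exact congrFun h ⟨n, by omega⟩

theorem card_last_ne_zero_le_card_degree_eq [Finite F] (d : ℕ) :
    Nat.card {v : Fin (d + 1) → F // v (Fin.last d) ≠ 0} ≤
      Nat.card {f : F[X] // f.degree = (d : WithBot ℕ)} := by
  have hcoeff : ∀ (v : Fin (d + 1) → F) (j : Fin (d + 1)),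
      (∑ i : Fin (d + 1), monomial (i : ℕ) (v i)).coeff j = v j := by
    intro v j
    simp [coeff_monomial, Fin.val_inj]
  refine Nat.card_le_card_of_injective
    (fun v => ⟨∑ i : Fin (d + 1), monomial (i : ℕ) (v.1 i), ?_⟩) ?_
  · refine le_antisymm ?_ (le_degree_of_ne_zero ?_)
    · refine (degree_sum_le _ _).trans (Finset.sup_le fun i _ => ?_)
      exact (degree_monomial_le _ _).trans (by exact_mod_cast Nat.lt_succ_iff.1 i.2)
    · have h := hcoeff v.1 (Fin.last d)
      rw [Fin.val_last] at h
      rw [h]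
      exact v.2
  · intro v w h
    refine Subtype.ext (funext fun j => ?_)
    rw [← hcoeff v.1 j, ← hcoeff w.1 j]
    exact congrArg (fun p => coeff p (j : ℕ)) (Subtype.ext_iff.1 h)

theorem card_minimalPeriod_eq_le [Finite F] {d k : ℕ} (hd : 0 < d) (hk : 0 < k)
    (hkd : k ≤ d + 1) :
    Nat.card (Σ f : {f : F[X] // f.degree = (d : WithBot ℕ)},
        {x : F // Function.minimalPeriod (fun x => f.1.eval x) x = k}) ≤
      Nat.card {f : F[X] // f.degree = (d : WithBot ℕ)} := by
  refine le_trans ?_ (card_last_ne_zero_le_card_degree_eq d)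
  refine Nat.card_le_card_of_injective (fun p => ⟨fun i : Fin (d + 1) =>
    if (i : ℕ) < k then (fun x => p.1.1.eval x)^[i] p.2.1 - (if (i : ℕ) = d then p.2.1 else 0)
    else p.1.1.coeff i, ?_⟩) ?_
  · obtain ⟨⟨f, hf⟩, x, hx⟩ := p
    simp only [Fin.val_last]
    split_ifs with h
    · rw [sub_ne_zero]
      exact Function.not_isPeriodicPt_of_pos_of_lt_minimalPeriod hd.ne' (hx ▸ h)
    · exact coeff_ne_zero_of_eq_degree hf
  · rintro ⟨⟨f, hf⟩, x, hx⟩ ⟨⟨g, hg⟩, y, hy⟩ h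
    have hv := fun i : Fin (d + 1) => congrFun (Subtype.ext_iff.1 h) i
    have hxy : x = y := by simpa [hk, hd.ne] using hv 0
    subst hxy
    have hiter : ∀ i ≤ k, (fun x => f.eval x)^[i] x = (fun x => g.eval x)^[i] x := by
      intro i hi
      rcases hi.lt_or_eq with hlt | rfl
      · simpa [hlt] using hv ⟨i, by omega⟩
      · have h₁ := Function.iterate_minimalPeriod (f := fun x => f.eval x) (x := x)
        have h₂ := Function.iterate_minimalPeriod (f := fun x => g.eval x) (x := x)
        rw [hx] at h₁
        rw [hy] at h₂
        rw [h₁, h₂]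
    have hdeg : (f - g).degree < ((Finset.range k).card : WithBot ℕ) := by
      rw [Finset.card_range, degree_lt_iff_coeff_zero]
      intro n hn
      rw [coeff_sub, sub_eq_zero]
      rcases Nat.lt_or_ge d n with hdn | hdn
      · rw [coeff_eq_zero_of_degree_lt (by rw [hf]; exact_mod_cast hdn),
          coeff_eq_zero_of_degree_lt (by rw [hg]; exact_mod_cast hdn)]
      · simpa [Nat.not_lt.2 hn] using hv ⟨n, by omega⟩
    have hfg : f = g := by
      refine eq_of_degree_sub_lt_of_eval_index_eq (Finset.range k)
        (v := fun i => (fun x => f.eval x)^[i] x) ?_ hdeg ?_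
      · intro a ha b hb hab
        refine Function.iterate_injOn_Iio_minimalPeriod (f := fun x => f.eval x) (x := x) ?_ ?_ hab
        · rw [hx]; simpa using ha
        · rw [hx]; simpa using hb
      · intro i hi
        have hik := Finset.mem_range.1 hi
        have h₁ := hiter (i + 1) hik
        rw [Function.iterate_succ_apply', Function.iterate_succ_apply', ← hiter i hik.le] at h₁
        exact h₁
    subst hfg
    rfl

end Counting

/-- **Corollary 2.4 (upper bound, small degree).** If `d < q - 1`, then the average number of
cycles of a degree-`d` polynomial over `F_q` is at most `Σ_{k=1}^{d+1} 1/k + q/(d+2)`. -/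
theorem avg_cycles_of_polynomials_upper_bound_small_degree
    (q d : ℕ) (F : Type) [Field F] [Fintype F] (hF : Fintype.card F = q)
    (hd : 0 < d) (hdq : d < q - 1) :
    (Nat.card {p : Polynomial F × Finset F //
        p.1.degree = (d : WithBot ℕ) ∧ IsCycleSet (fun x => p.1.eval x) p.2} : ℝ) /
      (Nat.card {f : Polynomial F // f.degree = (d : WithBot ℕ)} : ℝ)
      ≤ (∑ k ∈ Finset.Icc 1 (d + 1), (1 : ℝ) / k) + q / (d + 2) := by
  classical
  let D := {f : F[X] // f.degree = (d : WithBot ℕ)}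
  have : Fintype D := Fintype.ofFinite D
  let C : D → Finset (Finset F) := fun f => {c | IsCycleSet (fun x => f.1.eval x) c}
  have hC : ∀ f, ∀ c ∈ C f, IsCycleSet (fun x => f.1.eval x) c :=
    fun f c hc => (Finset.mem_filter.1 hc).2
  have hpairs : Nat.card {p : F[X] × Finset F //
      p.1.degree = (d : WithBot ℕ) ∧ IsCycleSet (fun x => p.1.eval x) p.2} =
      ∑ f : D, (C f).card := by
    rw [← Finset.card_sigma, ← Nat.card_eq_finsetCard]
    exact Nat.card_congr
      { toFun p := ⟨⟨⟨p.1.1, p.2.1⟩, p.1.2⟩, by simpa [C] using p.2.2⟩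
        invFun p := ⟨(p.1.1.1, p.1.2), p.1.1.2, hC _ _ (Finset.mem_sigma.1 p.2).2⟩ }
  have hshort : ∀ k ∈ Finset.Icc 1 (d + 1),
      k * ∑ f : D, ((C f).filter (fun c => c.card = k)).card ≤ Nat.card D := by
    intro k hk
    rw [Finset.mem_Icc] at hk
    refine le_trans ?_ (card_minimalPeriod_eq_le (F := F) hd hk.1 hk.2)
    rw [Nat.card_sigma, Finset.mul_sum]
    refine Finset.sum_le_sum fun f _ => ?_
    rw [Nat.card_eq_fintype_card, Fintype.card_subtype]
    refine mul_card_cycles_le (fun c hc => hC f c (Finset.mem_filter.1 hc).1)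
      (fun c hc => (Finset.mem_filter.1 hc).2.ge) fun c hc x hx => ?_
    rw [Finset.mem_filter] at hc
    simpa [← (hC f c hc.1).card_eq_minimalPeriod hx] using hc.2
  have hlong : ∀ f : D, (d + 2) * ((C f).filter (fun c => d + 2 ≤ c.card)).card ≤ q := by
    intro f
    rw [← hF, ← Finset.card_univ]
    exact mul_card_cycles_le (fun c hc => hC f c (Finset.mem_filter.1 hc).1)
      (fun c hc => (Finset.mem_filter.1 hc).2) fun c _ => Finset.subset_univ c
  have hsplit : ∀ f : D, (C f).card =
      ∑ k ∈ Finset.Icc 1 (d + 1), ((C f).filter (fun c => c.card = k)).card +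
        ((C f).filter (fun c => d + 2 ≤ c.card)).card := by
    intro f
    rw [← Finset.card_filter_add_card_filter_not (s := C f) (fun c => c.card ≤ d + 1)]
    congr 1
    · rw [Finset.card_eq_sum_card_fiberwise (f := Finset.card) (t := Finset.Icc 1 (d + 1))]
      · refine Finset.sum_congr rfl fun k hk => ?_
        rw [Finset.filter_filter]
        congr 1
        refine Finset.filter_congr fun c _ => ?_
        have := (Finset.mem_Icc.1 hk).2
        omega
      · intro c hc
        have hc := Finset.mem_filter.1 hc
        exact Finset.mem_coe.2 (Finset.mem_Icc.2 ⟨(hC f c hc.1).1.card_pos, hc.2⟩)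
    · congr 1
      refine Finset.filter_congr fun c _ => ?_
      omega
  rw [hpairs, Finset.sum_congr rfl fun f _ => hsplit f, Finset.sum_add_distrib, Finset.sum_comm]
  refine div_le_of_le_mul₀ (Nat.cast_nonneg _) (by positivity) ?_
  rw [add_mul, Finset.sum_mul, Nat.cast_add, Nat.cast_sum]
  refine add_le_add (Finset.sum_le_sum fun k hk => ?_) ?_
  · have hk0 : (0 : ℝ) < k := by exact_mod_cast (Finset.mem_Icc.1 hk).1
    rw [one_div, ← div_eq_inv_mul, le_div_iff₀' hk0]
    exact_mod_cast hshort k hk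
  · rw [div_mul_eq_mul_div, le_div_iff₀' (by positivity)]
    have h := Finset.sum_le_sum fun (f : D) (_ : f ∈ Finset.univ) => hlong f
    rw [← Finset.mul_sum, Finset.sum_const, Finset.card_univ, smul_eq_mul,
      ← Nat.card_eq_fintype_card, mul_comm _ q] at h
    exact_mod_cast h
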